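/- For every w ∈ EuclideanSpace ℝ (Fin d), ⨅_{(a,b) ∈ ℝ × ℝ} ⨆_{α ∈ ℝ} Σ_{t=1}^{T} f_t(w, a, b, α) = (T₊·T₋/T)·(F(w) - 1); in particular, the infimum over (a,b) and the supremum over α in the empirical saddle-point reformulation are attained at a = ⟨w, x̄⁺⟩, b = ⟨w, x̄⁻⟩, and α = ⟨w, x̄⁻⟩ - ⟨w, x̄⁺⟩. -/

import Mathlib

open scoped RealInnerProductSpace
open Finset

/-- Number of positively labeled samples. -/
def numPos (T : ℕ) (y : Fin T → ℤ) : ℕ := (Finset.univ.filter fun t => y t = 1).card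

/-- Number of negatively labeled samples. -/
def numNeg (T : ℕ) (y : Fin T → ℤ) : ℕ := (Finset.univ.filter fun t => y t = -1).card

/-- The mean of the positively labeled samples. -/
noncomputable def meanPos (d T : ℕ) (x : Fin T → EuclideanSpace ℝ (Fin d))
    (y : Fin T → ℤ) : EuclideanSpace ℝ (Fin d) :=
  ((numPos T y : ℝ))⁻¹ • ∑ t ∈ Finset.univ.filter fun t => y t = 1, x t

/-- The mean of the negatively labeled samples. -/
noncomputable def meanNeg (d T : ℕ) (x : Fin T → EuclideanSpace ℝ (Fin d))
    (y : Fin T → ℤ) : EuclideanSpace ℝ (Fin d) :=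
  ((numNeg T y : ℝ))⁻¹ • ∑ t ∈ Finset.univ.filter fun t => y t = -1, x t

/-- The per-sample loss `f_t(w, a, b, α)` of the empirical saddle-point reformulation,
where `p = T₊ / T`. -/
noncomputable def fsad (d T : ℕ) (x : Fin T → EuclideanSpace ℝ (Fin d)) (y : Fin T → ℤ)
    (w : EuclideanSpace ℝ (Fin d)) (a b α : ℝ) (t : Fin T) : ℝ :=
  let p : ℝ := (numPos T y : ℝ) / (T : ℝ)
  (1 - p) * (⟪w, x t⟫ - a) ^ 2 * (if y t = 1 then (1 : ℝ) else 0)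
    + p * (⟪w, x t⟫ - b) ^ 2 * (if y t = -1 then (1 : ℝ) else 0)
    - p * (1 - p) * α ^ 2
    + 2 * (1 + α) * ⟪w, x t⟫ *
        (p * (if y t = -1 then (1 : ℝ) else 0) - (1 - p) * (if y t = 1 then (1 : ℝ) else 0))

/-- The pairwise least-squares AUC surrogate objective. -/
noncomputable def lsAUC (d T : ℕ) (x : Fin T → EuclideanSpace ℝ (Fin d))
    (y : Fin T → ℤ) (w : EuclideanSpace ℝ (Fin d)) : ℝ :=
  (1 / ((numPos T y : ℝ) * (numNeg T y : ℝ))) *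
    ∑ s ∈ Finset.univ.filter fun s => y s = 1,
      ∑ t ∈ Finset.univ.filter fun t => y t = -1, (1 - ⟪w, x s - x t⟫) ^ 2

theorem numPos_add_numNeg (T : ℕ) (y : Fin T → ℤ) (hy : ∀ t, y t = 1 ∨ y t = -1) :
    numPos T y + numNeg T y = T := by
  have h : (univ.filter fun t => y t = -1) = univ.filter fun t => ¬ y t = 1 := by
    ext t
    have := hy t
    simp only [mem_filter, mem_univ, true_and]
    omega
  rw [numPos, numNeg, h, card_filter_add_card_filter_not, card_univ, Fintype.card_fin]

theorem inner_meanPos (d T : ℕ) (x : Fin T → EuclideanSpace ℝ (Fin d)) (y : Fin T → ℤ)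
    (w : EuclideanSpace ℝ (Fin d)) :
    ⟪w, meanPos d T x y⟫ = (∑ t ∈ univ.filter fun t => y t = 1, ⟪w, x t⟫) / numPos T y := by
  rw [meanPos, inner_smul_right, inner_sum, div_eq_inv_mul]

theorem inner_meanNeg (d T : ℕ) (x : Fin T → EuclideanSpace ℝ (Fin d)) (y : Fin T → ℤ)
    (w : EuclideanSpace ℝ (Fin d)) :
    ⟪w, meanNeg d T x y⟫ = (∑ t ∈ univ.filter fun t => y t = -1, ⟪w, x t⟫) / numNeg T y := by
  rw [meanNeg, inner_smul_right, inner_sum, div_eq_inv_mul]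

theorem sum_sub_const_sq {ι : Type*} (s : Finset ι) (u : ι → ℝ) (a : ℝ) :
    ∑ i ∈ s, (u i - a) ^ 2 = ∑ i ∈ s, u i ^ 2 - 2 * a * ∑ i ∈ s, u i + #s * a ^ 2 := by
  simp only [sub_sq, sum_add_distrib, sum_sub_distrib, sum_const, nsmul_eq_mul, mul_sum]
  congr 2
  exact sum_congr rfl fun i _ => by ring

theorem sum_sum_one_sub_sub_sq {ι : Type*} (s r : Finset ι) (u : ι → ℝ) :
    ∑ i ∈ s, ∑ j ∈ r, (1 - (u i - u j)) ^ 2 =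
      #s * #r - 2 * (#r * ∑ i ∈ s, u i - #s * ∑ j ∈ r, u j)
        + #r * ∑ i ∈ s, u i ^ 2 + #s * ∑ j ∈ r, u j ^ 2
        - 2 * (∑ i ∈ s, u i) * ∑ j ∈ r, u j := by
  have h (i : ι) : ∑ j ∈ r, (1 - (u i - u j)) ^ 2 =
      (∑ j ∈ r, u j ^ 2 + 2 * ∑ j ∈ r, u j + #r)
        - (2 * #r + 2 * ∑ j ∈ r, u j) * u i + #r * u i ^ 2 := by
    have := sum_sub_const_sq r u (u i - 1)
    rw [show ∑ j ∈ r, (1 - (u i - u j)) ^ 2 = ∑ j ∈ r, (u j - (u i - 1)) ^ 2 from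
      sum_congr rfl fun j _ => by ring, this]
    ring
  simp only [h, sum_add_distrib, sum_sub_distrib, sum_const, nsmul_eq_mul, ← mul_sum]
  ring

/-- Completing the squares in `a`, `b` and `α`. -/
theorem sum_fsad_eq (d T : ℕ) (x : Fin T → EuclideanSpace ℝ (Fin d)) (y : Fin T → ℤ)
    (hy : ∀ t, y t = 1 ∨ y t = -1) (hTp : 1 ≤ numPos T y) (hTn : 1 ≤ numNeg T y)
    (w : EuclideanSpace ℝ (Fin d)) (a b α : ℝ) :
    ∑ t, fsad d T x y w a b α t =
      ((numPos T y : ℝ) * (numNeg T y : ℝ) / (T : ℝ)) *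
        (lsAUC d T x y w - 1 + (a - ⟪w, meanPos d T x y⟫) ^ 2 + (b - ⟪w, meanNeg d T x y⟫) ^ 2
          - (α - (⟪w, meanNeg d T x y⟫ - ⟪w, meanPos d T x y⟫)) ^ 2) := by
  have hT : (T : ℝ) = numPos T y + numNeg T y := by
    exact_mod_cast (numPos_add_numNeg T y hy).symm
  have hm : (0 : ℝ) < numPos T y := by exact_mod_cast hTp
  have hn : (0 : ℝ) < numNeg T y := by exact_mod_cast hTn
  have hp : 1 - (numPos T y : ℝ) / T = numNeg T y / T := by
    rw [hT]
    field_simp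
    ring
  have hsum : ∑ t, fsad d T x y w a b α t =
      (numNeg T y / T : ℝ) * ∑ t ∈ univ.filter fun t => y t = 1, (⟪w, x t⟫ - a) ^ 2
        + (numPos T y / T : ℝ) * ∑ t ∈ univ.filter fun t => y t = -1, (⟪w, x t⟫ - b) ^ 2
        - T * ((numPos T y / T : ℝ) * (numNeg T y / T) * α ^ 2)
        + 2 * (1 + α) * ((numPos T y / T : ℝ) * ∑ t ∈ univ.filter fun t => y t = -1, ⟪w, x t⟫
          - (numNeg T y / T : ℝ) * ∑ t ∈ univ.filter fun t => y t = 1, ⟪w, x t⟫) := by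
    have hc : (T : ℝ) * ((numPos T y / T : ℝ) * (numNeg T y / T) * α ^ 2) =
        ∑ _t : Fin T, (numPos T y / T : ℝ) * (numNeg T y / T) * α ^ 2 := by simp
    rw [hc]
    simp only [sum_filter, mul_sum, ← sum_add_distrib, ← sum_sub_distrib]
    refine sum_congr rfl fun t _ => ?_
    simp only [fsad, hp]
    split_ifs <;> ring
  rw [hsum, lsAUC]
  simp only [inner_sub_right, inner_meanPos, inner_meanNeg]
  rw [sum_sub_const_sq, sum_sub_const_sq, sum_sum_one_sub_sub_sq _ _ fun t => ⟪w, x t⟫]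
  simp only [← numPos.eq_1, ← numNeg.eq_1, hT]
  have : (numPos T y : ℝ) + numNeg T y ≠ 0 := by positivity
  field_simp
  ring

/-- The inner inf–sup of the empirical saddle-point reformulation equals
`(T₊T₋/T)·(F(w) - 1)`; moreover the infimum over `(a, b)` and the supremum over `α`
are attained at `a = ⟨w, x̄⁺⟩`, `b = ⟨w, x̄⁻⟩`, `α = ⟨w, x̄⁻⟩ - ⟨w, x̄⁺⟩`. -/
theorem iInf_iSup_sum_fsad (d T : ℕ) (hd : 1 ≤ d) (hT : 1 ≤ T)
    (x : Fin T → EuclideanSpace ℝ (Fin d)) (y : Fin T → ℤ)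
    (hy : ∀ t, y t = 1 ∨ y t = -1)
    (hTp : 1 ≤ numPos T y) (hTn : 1 ≤ numNeg T y)
    (w : EuclideanSpace ℝ (Fin d)) :
    (⨅ ab : ℝ × ℝ, ⨆ α : ℝ, ∑ t, fsad d T x y w ab.1 ab.2 α t)
        = ((numPos T y : ℝ) * (numNeg T y : ℝ) / (T : ℝ)) * (lsAUC d T x y w - 1)
      ∧ (⨆ α : ℝ, ∑ t, fsad d T x y w ⟪w, meanPos d T x y⟫ ⟪w, meanNeg d T x y⟫ α t)
          = (⨅ ab : ℝ × ℝ, ⨆ α : ℝ, ∑ t, fsad d T x y w ab.1 ab.2 α t)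
      ∧ (∑ t, fsad d T x y w ⟪w, meanPos d T x y⟫ ⟪w, meanNeg d T x y⟫
            (⟪w, meanNeg d T x y⟫ - ⟪w, meanPos d T x y⟫) t)
          = (⨆ α : ℝ, ∑ t, fsad d T x y w ⟪w, meanPos d T x y⟫ ⟪w, meanNeg d T x y⟫ α t) := by
  have hT0 : (0 : ℝ) < T := by exact_mod_cast hT
  have hc : 0 ≤ (numPos T y : ℝ) * (numNeg T y : ℝ) / (T : ℝ) := by positivity
  have hsup (a b : ℝ) : (⨆ α : ℝ, ∑ t, fsad d T x y w a b α t) =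
      ((numPos T y : ℝ) * (numNeg T y : ℝ) / (T : ℝ)) *
        (lsAUC d T x y w - 1 + (a - ⟪w, meanPos d T x y⟫) ^ 2
          + (b - ⟪w, meanNeg d T x y⟫) ^ 2) := by
    simp only [sum_fsad_eq d T x y hy hTp hTn]
    refine IsGreatest.csSup_eq
      ⟨⟨⟪w, meanNeg d T x y⟫ - ⟪w, meanPos d T x y⟫, by simp⟩, ?_⟩
    rintro _ ⟨α, rfl⟩
    exact mul_le_mul_of_nonneg_left (sub_le_self _ (sq_nonneg _)) hc
  have hinf : (⨅ ab : ℝ × ℝ, ⨆ α : ℝ, ∑ t, fsad d T x y w ab.1 ab.2 α t) =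
      ((numPos T y : ℝ) * (numNeg T y : ℝ) / (T : ℝ)) * (lsAUC d T x y w - 1) := by
    simp only [hsup]
    refine IsLeast.csInf_eq ⟨⟨(⟪w, meanPos d T x y⟫, ⟪w, meanNeg d T x y⟫), by simp⟩, ?_⟩
    rintro _ ⟨ab, rfl⟩
    refine mul_le_mul_of_nonneg_left ?_ hc
    rw [add_assoc]
    exact le_add_of_nonneg_right (by positivity)
  refine ⟨hinf, ?_, ?_⟩
  · rw [hinf, hsup]
    simp
  · rw [hsup, sum_fsad_eq d T x y hy hTp hTn]
    simp
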